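/- Let d ≥ 1 and q be an odd prime power with d ≡ 1 (mod 4), or d ≡ 3 (mod 4) and q ≡ 1 (mod 4). Then for every set A ⊆ F_q^d, one has (as an inequality of real numbers) SQ(A) ≤ |A|²/2 − q^{(d−1)/2}·|A|/2 − |A|/2 + min{ q^{(d+1)/2}·|A|/2, q^{(d−1)/2}·|A|/2 + |A|²/2, |A|/2 + q^{(d+1)/2}·|A|/2 − |A|²/(2q) }. -/

import Mathlib

open Finset

/-- `‖x‖ = x₁² + ⋯ + x_d²` for `x ∈ F_q^d`. -/
def normSq {d : ℕ} {F : Type} [Field F] [Fintype F] (x : Fin d → F) : F := ∑ i, x i ^ 2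

/-- `SQ(A)` : the number of pairs `(x,y) ∈ A×A` with `η(‖x−y‖) = 1`,
where `η` is the quadratic character of `F` (with `η(0) = 0`). -/
noncomputable def SQpairs {d : ℕ} {F : Type} [Field F] [Fintype F] [DecidableEq F]
    (A : Finset (Fin d → F)) : ℕ :=
  ((A ×ˢ A).filter (fun p => quadraticChar F (normSq (p.1 - p.2)) = 1)).card

/-- The quadratic character of `F` with complex values. -/
noncomputable def complexQuadraticChar (F : Type) [Field F] [Fintype F] [DecidableEq F] :
    MulChar F ℂ :=
  (quadraticChar F).ringHomComp (Int.castRingHom ℂ)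

section

variable {F : Type} [Field F] [Fintype F] [DecidableEq F]

lemma four_ne_zero_of_ringChar_ne_two {F : Type} [Field F] (hF : ringChar F ≠ 2) :
    (4 : F) ≠ 0 := by
  have h2 : (2 : F) ≠ 0 := Ring.two_ne_zero hF
  have h : (4 : F) = 2 * 2 := by norm_num
  rw [h]
  exact mul_ne_zero h2 h2

lemma complexQuadraticChar_apply (a : F) :
    complexQuadraticChar F a = ((quadraticChar F a : ℤ) : ℂ) := rfl

lemma complexQuadraticChar_isQuadratic : (complexQuadraticChar F).IsQuadratic :=
  MulChar.IsQuadratic.comp (quadraticChar_isQuadratic F) _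

lemma complexQuadraticChar_ne_one (hF : ringChar F ≠ 2) : complexQuadraticChar F ≠ 1 :=
  MulChar.ringHomComp_ne_one_iff Int.cast_injective |>.2 (quadraticChar_ne_one hF)

lemma complexQuadraticChar_sq {a : F} (ha : a ≠ 0) : complexQuadraticChar F a ^ 2 = 1 := by
  rw [complexQuadraticChar_apply]
  exact_mod_cast quadraticChar_sq_one ha

lemma complexQuadraticChar_pow_odd (k : ℕ) (a : F) :
    complexQuadraticChar F a ^ (2 * k + 1) = complexQuadraticChar F a := by
  by_cases ha : a = 0
  · simp [ha, MulChar.map_zero]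
  · rw [pow_succ, pow_mul, complexQuadraticChar_sq ha, one_pow, one_mul]

lemma complexQuadraticChar_inv_four_mul (hF : ringChar F ≠ 2) (a : F) :
    complexQuadraticChar F (4 * a)⁻¹ = complexQuadraticChar F a := by
  have h2 : (2 : F) ≠ 0 := Ring.two_ne_zero hF
  by_cases ha : a = 0
  · simp [ha]
  · have h : (4 * a)⁻¹ = ((2 * a)⁻¹) ^ 2 * a := by
      have h4 := four_ne_zero_of_ringChar_ne_two hF
      field_simp
      norm_num
    rw [h, map_mul, map_pow, complexQuadraticChar_sq, one_mul]
    exact inv_ne_zero (mul_ne_zero h2 ha)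

lemma sum_complexQuadraticChar_mul (hF : ringChar F ≠ 2) (ψ : AddChar F ℂ) (t : F) :
    ∑ u, complexQuadraticChar F u * ψ (t * u) =
      complexQuadraticChar F t * gaussSum (complexQuadraticChar F) ψ := by
  by_cases ht : t = 0
  · simp [ht, MulChar.map_zero, MulChar.sum_eq_zero_of_ne_one (complexQuadraticChar_ne_one hF)]
  · have h := gaussSum_mulShift_eq (complexQuadraticChar F) ψ (Units.mk0 t ht)
    rw [complexQuadraticChar_isQuadratic.inv] at h
    simpa [gaussSum] using h

lemma sum_addChar_mul_sq (hF : ringChar F ≠ 2) {ψ : AddChar F ℂ} (hψ : ψ.IsPrimitive)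
    {s : F} (hs : s ≠ 0) :
    ∑ x, ψ (s * x ^ 2) = complexQuadraticChar F s * gaussSum (complexQuadraticChar F) ψ := by
  have h1 : ∑ x, ψ (s * x ^ 2) = ∑ a, (complexQuadraticChar F a + 1) * ψ (s * a) := by
    rw [← Finset.sum_fiberwise (s := Finset.univ) (g := fun x : F => x ^ 2)]
    refine Finset.sum_congr rfl fun a _ => ?_
    rw [Finset.sum_congr rfl (g := fun _ => ψ (s * a)) (fun x hx => by
      rw [(Finset.mem_filter.1 hx).2]), Finset.sum_const, nsmul_eq_mul]
    congr 1
    have := quadraticChar_card_sqrts hF a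
    rw [complexQuadraticChar_apply, ← Int.cast_one (R := ℂ), ← Int.cast_add, ← this]
    norm_cast
    congr 1
    ext x
    simp
  have h2 : ∑ a, ψ (s * a) = 0 := by
    have := AddChar.sum_mulShift s hψ
    simpa [mul_comm, hs] using this
  rw [h1, ← sum_complexQuadraticChar_mul hF ψ s]
  simp_rw [add_mul, one_mul]
  rw [Finset.sum_add_distrib, h2, add_zero]

lemma sum_addChar_quadratic (hF : ringChar F ≠ 2) {ψ : AddChar F ℂ} (hψ : ψ.IsPrimitive)
    {s : F} (hs : s ≠ 0) (b : F) :
    ∑ x, ψ (s * x ^ 2 + b * x) =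
      complexQuadraticChar F s * gaussSum (complexQuadraticChar F) ψ *
        ψ (-(b ^ 2) * (4 * s)⁻¹) := by
  have h2 : (2 : F) ≠ 0 := Ring.two_ne_zero hF
  have h4 := four_ne_zero_of_ringChar_ne_two hF
  rw [← sum_addChar_mul_sq hF hψ hs, Finset.sum_mul]
  refine Fintype.sum_equiv (Equiv.addRight (b * (2 * s)⁻¹)) _ _ fun x => ?_
  rw [← AddChar.map_add_eq_mul]
  congr 1
  simp only [Equiv.coe_addRight]
  field_simp
  ring

lemma addChar_map_sum {F : Type} [Field F] {d : ℕ} (ψ : AddChar F ℂ) (f : Fin d → F) :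
    ψ (∑ i, f i) = ∏ i, ψ (f i) := by
  exact map_prod ψ.toMonoidHom (fun i => Multiplicative.ofAdd (f i)) Finset.univ

lemma sum_addChar_vec {F : Type} [Field F] [Fintype F] {d : ℕ} (f : Fin d → F → F) (ψ : AddChar F ℂ) :
    ∑ m : Fin d → F, ψ (∑ i, f i (m i)) = ∏ i, ∑ y, ψ (f i y) := by
  have h := Finset.sum_prod_piFinset (ι := Fin d) (Finset.univ : Finset F)
    (fun i y => ψ (f i y))
  rw [Fintype.piFinset_univ] at h
  rw [← h]
  exact Finset.sum_congr rfl fun m _ => addChar_map_sum _ _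

lemma sum_addChar_normSq {d : ℕ} (hF : ringChar F ≠ 2) {ψ : AddChar F ℂ} (hψ : ψ.IsPrimitive)
    {s : F} (hs : s ≠ 0) (x : Fin d → F) :
    ∑ m : Fin d → F, ψ (s * normSq m + m ⬝ᵥ x) =
      (complexQuadraticChar F s * gaussSum (complexQuadraticChar F) ψ) ^ d *
        ψ (-normSq x * (4 * s)⁻¹) := by
  have h := sum_addChar_vec (fun i y => s * y ^ 2 + x i * y) ψ
  simp only [sum_addChar_quadratic hF hψ hs, Finset.prod_mul_distrib, Finset.prod_const,
    Finset.card_univ, Fintype.card_fin] at h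
  convert h using 3 with m
  · rw [Finset.sum_add_distrib, normSq, Finset.mul_sum, dotProduct]
    simp only [mul_comm]
  · rw [mul_pow]
  · rw [← addChar_map_sum, normSq, ← Finset.sum_neg_distrib, Finset.sum_mul]

lemma sum_addChar_dotProduct {d : ℕ} {ψ : AddChar F ℂ} (hψ : ψ.IsPrimitive)
    (x : Fin d → F) :
    ∑ m : Fin d → F, ψ (m ⬝ᵥ x) = if x = 0 then (Fintype.card F : ℂ) ^ d else 0 := by
  have h := sum_addChar_vec (fun i y => y * x i) ψ
  simp only [AddChar.sum_mulShift _ hψ] at h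
  rw [show (∑ m : Fin d → F, ψ (m ⬝ᵥ x)) = _ from h]
  split_ifs with hx
  · simp [hx]
  · obtain ⟨i, hi⟩ := Function.ne_iff.1 hx
    exact Finset.prod_eq_zero (Finset.mem_univ i) (by simpa using hi)

lemma sum_inv_four_mul (hF : ringChar F ≠ 2) (f : F → ℂ) :
    ∑ s, f (4 * s)⁻¹ = ∑ s, f s := by
  have h4 := four_ne_zero_of_ringChar_ne_two hF
  refine Fintype.sum_equiv (Function.Involutive.toPerm (fun s : F => (4 * s)⁻¹) fun s => ?_)
    _ _ fun s => rfl
  by_cases hs : s = 0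
  · simp [hs]
  · field_simp

/-- The Fourier transform of the indicator function of the cone `‖m‖ = 0`. -/
lemma sum_cone_addChar {k : ℕ} (hF : ringChar F ≠ 2) {ψ : AddChar F ℂ} (hψ : ψ.IsPrimitive)
    (x : Fin (2 * k + 1) → F) :
    (Fintype.card F : ℂ) * ∑ m : Fin (2 * k + 1) → F,
        (if normSq m = 0 then 1 else 0) * ψ (m ⬝ᵥ x) =
      (if x = 0 then (Fintype.card F : ℂ) ^ (2 * k + 1) else 0) +
        gaussSum (complexQuadraticChar F) ψ ^ (2 * k + 2) *
          complexQuadraticChar F (-normSq x) := by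
  set G := gaussSum (complexQuadraticChar F) ψ with hG
  have h1 : (Fintype.card F : ℂ) * ∑ m : Fin (2 * k + 1) → F,
        (if normSq m = 0 then 1 else 0) * ψ (m ⬝ᵥ x) =
      ∑ s, ∑ m : Fin (2 * k + 1) → F, ψ (s * normSq m + m ⬝ᵥ x) := by
    rw [Finset.sum_comm, Finset.mul_sum]
    refine Finset.sum_congr rfl fun m _ => ?_
    simp_rw [AddChar.map_add_eq_mul]
    rw [← Finset.sum_mul, AddChar.sum_mulShift _ hψ]
    split_ifs <;> simp
  have h2 : ∀ s, ∑ m : Fin (2 * k + 1) → F, ψ (s * normSq m + m ⬝ᵥ x) =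
      (if s = 0 then (if x = 0 then (Fintype.card F : ℂ) ^ (2 * k + 1) else 0) else 0) +
        G ^ (2 * k + 1) * (complexQuadraticChar F (4 * s)⁻¹ * ψ (-normSq x * (4 * s)⁻¹)) := by
    intro s
    by_cases hs : s = 0
    · simp [hs, MulChar.map_zero, sum_addChar_dotProduct hψ]
    · rw [sum_addChar_normSq hF hψ hs, mul_pow, complexQuadraticChar_pow_odd,
        complexQuadraticChar_inv_four_mul hF, if_neg hs]
      ring
  rw [h1]
  simp_rw [h2]
  rw [Finset.sum_add_distrib, ← Finset.mul_sum,
    sum_inv_four_mul hF (fun u => complexQuadraticChar F u * ψ (-normSq x * u)),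
    sum_complexQuadraticChar_mul hF, ← hG]
  simp only [Finset.sum_ite_eq', Finset.mem_univ, if_true]
  ring

/-- The Fourier transform of `m ↦ η(‖m‖)`. -/
lemma sum_complexQuadraticChar_normSq_addChar {k : ℕ} (hF : ringChar F ≠ 2)
    {ψ : AddChar F ℂ} (hψ : ψ.IsPrimitive) (x : Fin (2 * k + 1) → F) :
    ∑ m : Fin (2 * k + 1) → F, complexQuadraticChar F (normSq m) * ψ (m ⬝ᵥ x) =
      gaussSum (complexQuadraticChar F) ψ ^ (2 * k) *
        ((if normSq x = 0 then (Fintype.card F : ℂ) else 0) - 1) := by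
  set G := gaussSum (complexQuadraticChar F) ψ with hG
  have hG0 : G ≠ 0 := gaussSum_ne_zero_of_nontrivial
    (by exact_mod_cast Fintype.card_ne_zero) (complexQuadraticChar_ne_one hF) hψ
  have h1 : G * ∑ m : Fin (2 * k + 1) → F, complexQuadraticChar F (normSq m) * ψ (m ⬝ᵥ x) =
      ∑ s, complexQuadraticChar F s *
        ∑ m : Fin (2 * k + 1) → F, ψ (s * normSq m + m ⬝ᵥ x) := by
    simp_rw [Finset.mul_sum]
    rw [Finset.sum_comm]
    refine Finset.sum_congr rfl fun m _ => ?_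
    simp_rw [AddChar.map_add_eq_mul, ← mul_assoc]
    rw [← Finset.sum_mul, mul_comm G, ← sum_complexQuadraticChar_mul hF]
    simp_rw [mul_comm (normSq m)]
  have h2 : ∀ s, complexQuadraticChar F s *
        ∑ m : Fin (2 * k + 1) → F, ψ (s * normSq m + m ⬝ᵥ x) =
      G ^ (2 * k + 1) * (ψ (-normSq x * (4 * s)⁻¹) - if s = 0 then 1 else 0) := by
    intro s
    by_cases hs : s = 0
    · simp [hs, MulChar.map_zero]
    · rw [sum_addChar_normSq hF hψ hs, mul_pow, complexQuadraticChar_pow_odd, if_neg hs]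
      linear_combination (G ^ (2 * k + 1) * ψ (-normSq x * (4 * s)⁻¹)) *
        complexQuadraticChar_sq hs
  have h3 : ∑ u, ψ (-normSq x * u) = if normSq x = 0 then (Fintype.card F : ℂ) else 0 := by
    have := AddChar.sum_mulShift (-normSq x) hψ
    simp_rw [mul_comm (-normSq x)]
    rw [this]
    simp
  apply mul_left_cancel₀ hG0
  rw [h1]
  simp_rw [h2]
  rw [← Finset.mul_sum, Finset.sum_sub_distrib,
    sum_inv_four_mul hF (fun u => ψ (-normSq x * u)), h3]
  simp only [Finset.sum_ite_eq', Finset.mem_univ, if_true]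
  ring

lemma sum_mul_norm_sq_fourier {F : Type} [Field F] [Fintype F] {d : ℕ} (ψ : AddChar F ℂ) (A : Finset (Fin d → F))
    (f : (Fin d → F) → ℂ) :
    ∑ m, f m * ((‖∑ x ∈ A, ψ (m ⬝ᵥ x)‖ ^ 2 : ℝ) : ℂ) =
      ∑ p ∈ A ×ˢ A, ∑ m, f m * ψ (m ⬝ᵥ (p.1 - p.2)) := by
  rw [Finset.sum_comm]
  refine Finset.sum_congr rfl fun m _ => ?_
  rw [← Finset.mul_sum, Finset.sum_product]
  congr 1
  push_cast
  rw [← Complex.mul_conj', map_sum, Finset.sum_mul_sum]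
  refine Finset.sum_congr rfl fun x _ => Finset.sum_congr rfl fun y _ => ?_
  rw [dotProduct_sub, sub_eq_add_neg, AddChar.map_add_eq_mul, AddChar.map_neg_eq_conj]

end

section

variable {F : Type} [Field F] [Fintype F] [DecidableEq F]

lemma sum_product_sub_eq_zero {F : Type} [Field F] [DecidableEq F] {d : ℕ} (A : Finset (Fin d → F)) (c : ℂ) :
    ∑ p ∈ A ×ˢ A, (if p.1 - p.2 = 0 then c else 0) = A.card * c := by
  rw [Finset.sum_product]
  simp [sub_eq_zero, Finset.sum_ite_eq]

lemma gaussSum_pow_two_mul (hF : ringChar F ≠ 2) {ψ : AddChar F ℂ} (hψ : ψ.IsPrimitive)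
    (k : ℕ) :
    gaussSum (complexQuadraticChar F) ψ ^ (2 * k) =
      complexQuadraticChar F (-1) ^ k * (Fintype.card F : ℂ) ^ k := by
  rw [pow_mul, gaussSum_sq (complexQuadraticChar_ne_one hF) complexQuadraticChar_isQuadratic hψ,
    mul_pow]

/-- The energy of the pairs of `A` weighted by the quadratic character of their distance. -/
noncomputable def quadraticCharSum {d : ℕ} (A : Finset (Fin d → F)) : ℝ :=
  ∑ p ∈ A ×ˢ A, ((quadraticChar F (normSq (p.1 - p.2)) : ℤ) : ℝ)

/-- The number of pairs of `A` at distance zero. -/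
noncomputable def isotropicPairs {d : ℕ} (A : Finset (Fin d → F)) : ℝ :=
  ∑ p ∈ A ×ˢ A, if normSq (p.1 - p.2) = 0 then (1 : ℝ) else 0

lemma two_mul_SQpairs {d : ℕ} (A : Finset (Fin d → F)) :
    2 * (SQpairs A : ℝ) = (A.card : ℝ) ^ 2 - isotropicPairs A + quadraticCharSum A := by
  have h : (A.card : ℝ) ^ 2 = ∑ _p ∈ A ×ˢ A, (1 : ℝ) := by
    simp [sq]
  rw [h, isotropicPairs, quadraticCharSum, SQpairs, Finset.card_filter, ← Finset.sum_sub_distrib,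
    ← Finset.sum_add_distrib, Nat.cast_sum, Finset.mul_sum]
  refine Finset.sum_congr rfl fun p _ => ?_
  by_cases h0 : normSq (p.1 - p.2) = 0
  · simp [h0]
  · rcases quadraticChar_dichotomy h0 with h1 | h1 <;> (simp [h0, h1]; try norm_num)

lemma card_le_isotropicPairs {d : ℕ} (A : Finset (Fin d → F)) :
    (A.card : ℝ) ≤ isotropicPairs A := by
  have h : (A.card : ℝ) = ∑ p ∈ A ×ˢ A, if p.1 - p.2 = 0 then (1 : ℝ) else 0 := by
    rw [Finset.sum_product]
    simp [sub_eq_zero, Finset.sum_ite_eq]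
  rw [h, isotropicPairs]
  refine Finset.sum_le_sum fun p _ => ?_
  by_cases hp : p.1 - p.2 = 0
  · rw [hp]
    simp [normSq]
  · rw [if_neg hp]
    split_ifs <;> norm_num

lemma quadraticCharSum_le {d : ℕ} (A : Finset (Fin d → F)) :
    quadraticCharSum A ≤ (A.card : ℝ) ^ 2 - isotropicPairs A := by
  have h : (A.card : ℝ) ^ 2 = ∑ _p ∈ A ×ˢ A, (1 : ℝ) := by
    simp [sq]
  rw [h, isotropicPairs, quadraticCharSum, ← Finset.sum_sub_distrib]
  refine Finset.sum_le_sum fun p _ => ?_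
  by_cases h0 : normSq (p.1 - p.2) = 0
  · simp [h0]
  · rcases quadraticChar_dichotomy h0 with h1 | h1 <;> simp [h0, h1]

lemma sum_norm_sq_fourier {d : ℕ} {ψ : AddChar F ℂ} (hψ : ψ.IsPrimitive)
    (A : Finset (Fin d → F)) :
    ∑ m : Fin d → F, ‖∑ x ∈ A, ψ (m ⬝ᵥ x)‖ ^ 2 = (Fintype.card F : ℝ) ^ d * A.card := by
  have h := sum_mul_norm_sq_fourier ψ A (fun _ => 1)
  simp only [one_mul, sum_addChar_dotProduct hψ, sum_product_sub_eq_zero] at h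
  rw [mul_comm]
  exact_mod_cast h

lemma sum_cone_norm_sq_fourier {k : ℕ} (hF : ringChar F ≠ 2) {ψ : AddChar F ℂ}
    (hψ : ψ.IsPrimitive) (hk : complexQuadraticChar F (-1) ^ k = 1)
    (A : Finset (Fin (2 * k + 1) → F)) :
    (Fintype.card F : ℝ) * ∑ m : Fin (2 * k + 1) → F,
        (if normSq m = 0 then 1 else 0) * ‖∑ x ∈ A, ψ (m ⬝ᵥ x)‖ ^ 2 =
      (Fintype.card F : ℝ) ^ (2 * k + 1) * A.card +
        (Fintype.card F : ℝ) ^ (k + 1) * quadraticCharSum A := by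
  have h := sum_mul_norm_sq_fourier ψ A (fun m => if normSq m = 0 then 1 else 0)
  have hneg : complexQuadraticChar F (-1) ^ 2 = 1 :=
    complexQuadraticChar_sq (neg_ne_zero.2 one_ne_zero)
  have h2 : ∀ x : Fin (2 * k + 1) → F,
      gaussSum (complexQuadraticChar F) ψ ^ (2 * k + 2) * complexQuadraticChar F (-normSq x) =
        (Fintype.card F : ℂ) ^ (k + 1) * complexQuadraticChar F (normSq x) := by
    intro x
    rw [← neg_one_mul, map_mul, show 2 * k + 2 = 2 * (k + 1) by ring,
      gaussSum_pow_two_mul hF hψ, pow_succ, hk]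
    linear_combination ((Fintype.card F : ℂ) ^ (k + 1) * complexQuadraticChar F (normSq x)) * hneg
  replace h := congrArg (fun z => (Fintype.card F : ℂ) * z) h
  rw [Finset.mul_sum (A ×ˢ A)] at h
  simp only [sum_cone_addChar hF hψ, h2] at h
  rw [Finset.sum_add_distrib, sum_product_sub_eq_zero, ← Finset.mul_sum] at h
  apply Complex.ofReal_injective
  rw [quadraticCharSum]
  push_cast
  simp only [complexQuadraticChar_apply] at h
  rw [mul_comm (A.card : ℂ)] at h
  rw [← h]
  push_cast
  simp only [apply_ite Complex.ofReal, Complex.ofReal_one, Complex.ofReal_zero]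

lemma sum_quadraticChar_norm_sq_fourier {k : ℕ} (hF : ringChar F ≠ 2) {ψ : AddChar F ℂ}
    (hψ : ψ.IsPrimitive) (hk : complexQuadraticChar F (-1) ^ k = 1)
    (A : Finset (Fin (2 * k + 1) → F)) :
    ∑ m : Fin (2 * k + 1) → F,
        ((quadraticChar F (normSq m) : ℤ) : ℝ) * ‖∑ x ∈ A, ψ (m ⬝ᵥ x)‖ ^ 2 =
      (Fintype.card F : ℝ) ^ k *
        (Fintype.card F * isotropicPairs A - (A.card : ℝ) ^ 2) := by
  have h := sum_mul_norm_sq_fourier ψ A (fun m => complexQuadraticChar F (normSq m))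
  have hn : (A.card : ℂ) ^ 2 = ∑ _p ∈ A ×ˢ A, (1 : ℂ) := by
    simp [sq]
  simp only [sum_complexQuadraticChar_normSq_addChar hF hψ, gaussSum_pow_two_mul hF hψ, hk,
    one_mul] at h
  rw [← Finset.mul_sum, Finset.sum_sub_distrib, ← hn] at h
  apply Complex.ofReal_injective
  rw [isotropicPairs]
  push_cast
  simp only [complexQuadraticChar_apply] at h
  push_cast at h
  rw [h, Finset.mul_sum]
  simp only [apply_ite Complex.ofReal, mul_ite, mul_one, mul_zero, Complex.ofReal_one,
    Complex.ofReal_zero]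

lemma quadraticCharSum_le_mul_card {k : ℕ} (hF : ringChar F ≠ 2)
    (hk : complexQuadraticChar F (-1) ^ k = 1) (A : Finset (Fin (2 * k + 1) → F)) :
    quadraticCharSum A ≤
      (Fintype.card F : ℝ) ^ (k + 1) * A.card - (Fintype.card F : ℝ) ^ k * A.card := by
  have hψ := AddChar.FiniteField.primitiveChar_to_Complex_isPrimitive F
  set ψ := AddChar.FiniteField.primitiveChar_to_Complex F
  have hq : (0 : ℝ) < Fintype.card F := by exact_mod_cast Fintype.card_pos
  have h1 := sum_norm_sq_fourier hψ A
  have h2 := sum_cone_norm_sq_fourier hF hψ hk A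
  have h3 : ∑ m : Fin (2 * k + 1) → F,
        (if normSq m = 0 then 1 else 0) * ‖∑ x ∈ A, ψ (m ⬝ᵥ x)‖ ^ 2 ≤
      ∑ m : Fin (2 * k + 1) → F, ‖∑ x ∈ A, ψ (m ⬝ᵥ x)‖ ^ 2 := by
    refine Finset.sum_le_sum fun m _ => mul_le_of_le_one_left (by positivity) ?_
    split_ifs <;> norm_num
  have h4 := mul_le_mul_of_nonneg_left h3 hq.le
  rw [h2, h1] at h4
  refine le_of_mul_le_mul_left ?_ (pow_pos hq (k + 1))
  linear_combination h4

lemma quadraticCharSum_le_add_isotropicPairs {k : ℕ} (hF : ringChar F ≠ 2)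
    (hk : complexQuadraticChar F (-1) ^ k = 1) (A : Finset (Fin (2 * k + 1) → F)) :
    quadraticCharSum A ≤ isotropicPairs A + (Fintype.card F : ℝ) ^ (k + 1) * A.card -
      (Fintype.card F : ℝ) ^ k * A.card - (A.card : ℝ) ^ 2 / Fintype.card F := by
  have hψ := AddChar.FiniteField.primitiveChar_to_Complex_isPrimitive F
  set ψ := AddChar.FiniteField.primitiveChar_to_Complex F
  have hq : (1 : ℝ) ≤ Fintype.card F := by exact_mod_cast Fintype.card_pos
  have hq0 : (Fintype.card F : ℝ) ≠ 0 := by positivity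
  have h1 := sum_norm_sq_fourier hψ A
  have h2 := sum_cone_norm_sq_fourier hF hψ hk A
  have h3 := sum_quadraticChar_norm_sq_fourier hF hψ hk A
  have h4 : 0 ≤ ∑ m : Fin (2 * k + 1) → F,
      ((Fintype.card F : ℝ) - Fintype.card F * (if normSq m = 0 then 1 else 0) +
        ((quadraticChar F (normSq m) : ℤ) : ℝ)) * ‖∑ x ∈ A, ψ (m ⬝ᵥ x)‖ ^ 2 := by
    refine Finset.sum_nonneg fun m _ => mul_nonneg ?_ (by positivity)
    by_cases h0 : normSq m = 0
    · simp [h0]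
    · rcases quadraticChar_dichotomy h0 with h | h <;> simp [h0, h]
      · positivity
      · exact_mod_cast hq
  simp only [add_mul, sub_mul, Finset.sum_add_distrib, Finset.sum_sub_distrib, mul_assoc,
    ← Finset.mul_sum] at h4
  rw [h1, h2, h3] at h4
  refine le_of_mul_le_mul_left ?_ (pow_pos (zero_lt_one.trans_le hq) (k + 1))
  have h5 : (Fintype.card F : ℝ) ^ (k + 1) * ((A.card : ℝ) ^ 2 / Fintype.card F) =
      (Fintype.card F : ℝ) ^ k * (A.card : ℝ) ^ 2 := by
    field_simp
    ring
  linear_combination h4 + h5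

lemma complexQuadraticChar_neg_one_pow (hF : ringChar F ≠ 2) {k : ℕ}
    (hk : Even k ∨ Fintype.card F % 4 = 1) : complexQuadraticChar F (-1) ^ k = 1 := by
  rcases hk with ⟨j, rfl⟩ | hq
  · rw [← two_mul, pow_mul, complexQuadraticChar_sq (neg_ne_zero.2 one_ne_zero), one_pow]
  · rw [complexQuadraticChar_apply, quadraticChar_neg_one hF, ZMod.χ₄_nat_one_mod_four hq]
    simp

end

theorem square_distances_odd_plus (q d : ℕ) (F : Type) [Field F] [Fintype F] [DecidableEq F]
    (hcard : Fintype.card F = q) (hodd : Odd q)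
    (hd : d % 4 = 1 ∨ (d % 4 = 3 ∧ q % 4 = 1)) (hd1 : 1 ≤ d)
    (A : Finset (Fin d → F)) :
    (SQpairs A : ℝ) ≤ (A.card : ℝ) ^ 2 / 2 - (q : ℝ) ^ ((d - 1) / 2) * (A.card : ℝ) / 2 - (A.card : ℝ) / 2
      + min (min ((q : ℝ) ^ ((d + 1) / 2) * (A.card : ℝ) / 2)
          ((q : ℝ) ^ ((d - 1) / 2) * (A.card : ℝ) / 2 + (A.card : ℝ) ^ 2 / 2))
        ((A.card : ℝ) / 2 + (q : ℝ) ^ ((d + 1) / 2) * (A.card : ℝ) / 2 - (A.card : ℝ) ^ 2 / (2 * q)) := by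
  subst hcard
  obtain ⟨k, rfl⟩ : ∃ k, d = 2 * k + 1 := ⟨d / 2, by omega⟩
  have hF : ringChar F ≠ 2 := fun h => by
    have := FiniteField.even_card_of_char_two h
    rw [Nat.odd_iff] at hodd
    omega
  have hk : complexQuadraticChar F (-1) ^ k = 1 := by
    refine complexQuadraticChar_neg_one_pow hF (hd.imp (fun h => ?_) And.right)
    rw [Nat.even_iff]
    omega
  have e1 : (2 * k + 1 - 1) / 2 = k := by omega
  have e2 : (2 * k + 1 + 1) / 2 = k + 1 := by omega
  rw [e1, e2, ← sub_le_iff_le_add', le_min_iff, le_min_iff]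
  have h1 := two_mul_SQpairs A
  have h2 := card_le_isotropicPairs A
  have h3 := quadraticCharSum_le A
  have h4 := quadraticCharSum_le_mul_card hF hk A
  have h5 := quadraticCharSum_le_add_isotropicPairs hF hk A
  have hn : (0 : ℝ) ≤ A.card := Nat.cast_nonneg _
  have h6 : (A.card : ℝ) ^ 2 / (2 * Fintype.card F) = (A.card : ℝ) ^ 2 / Fintype.card F / 2 := by
    ring
  rw [h6]
  refine ⟨⟨?_, ?_⟩, ?_⟩ <;> linarith
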